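/- Maurer–Cartan decomposition for the real Jacobi group: let a, b, c, d : ℝ → M(n,ℝ), λ, μ : ℝ → M(1,n,ℝ), κ : ℝ → ℝ be differentiable with [[a(t),b(t)],[c(t),d(t)]] ∈ Sp(n,ℝ) for all t; set p := λdᵗ − μcᵗ, q := −λbᵗ + μaᵗ, and let g(t) be the embedded (2n+2)×(2n+2) matrix with block rows [a, 0_{n×1}, b, qᵗ], [λ, 1, μ, κ], [c, 0_{n×1}, d, −pᵗ], [0_{1×n}, 0, 0_{1×n}, 1]. Then g(t)^{-1}·g'(t) is the block matrix whose nonzero blocks are A₁₁ = dᵗa' − bᵗc', A₁₃ = dᵗb' − bᵗd', A₁₄ = (μ' − p·b' − q·d')ᵗ, A₂₁ = λ' − p·a' − q·c', A₂₃ = μ' − p·b' − q·d', A₂₄ = κ' − p·q'ᵗ + q·p'ᵗ, A₃₁ = −cᵗa' + aᵗc', A₃₃ = −(dᵗa' − bᵗc')ᵗ, A₃₄ = −(λ' − p·a' − q·c')ᵗ, all remaining blocks being zero; moreover λ^F := dᵗb' − bᵗd' and λ^G := −cᵗa' + aᵗc' are symmetric matrices. -/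

import Mathlib

open Matrix

/-- The standard symplectic structure matrix `J` with `n×n` blocks `[[0, I],[−I, 0]]`. -/
def Jmat (n : ℕ) : Matrix (Fin n ⊕ Fin n) (Fin n ⊕ Fin n) ℝ :=
  fromBlocks 0 1 (-1) 0

/-- Entrywise derivative of a matrix-valued function of a real variable. -/
noncomputable def mderiv {m k : Type*} (f : ℝ → Matrix m k ℝ) (t : ℝ) : Matrix m k ℝ :=
  Matrix.of fun i j => deriv (fun s => f s i j) t

section mderiv

variable {l m k o : Type*}

theorem mderiv_congr {f g : ℝ → Matrix m k ℝ} (h : ∀ s, f s = g s) (t : ℝ) :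
    mderiv f t = mderiv g t := by
  rw [funext h]

theorem mderiv_const (M : Matrix m k ℝ) (t : ℝ) : mderiv (fun _ => M) t = 0 := by
  ext i j
  simp [mderiv]

theorem mderiv_transpose (f : ℝ → Matrix m k ℝ) (t : ℝ) :
    mderiv (fun s => (f s)ᵀ) t = (mderiv f t)ᵀ :=
  rfl

theorem mderiv_fromBlocks (A : ℝ → Matrix l k ℝ) (B : ℝ → Matrix l o ℝ)
    (C : ℝ → Matrix m k ℝ) (D : ℝ → Matrix m o ℝ) (t : ℝ) :
    mderiv (fun s => fromBlocks (A s) (B s) (C s) (D s)) t =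
      fromBlocks (mderiv A t) (mderiv B t) (mderiv C t) (mderiv D t) := by
  ext (i | i) (j | j) <;> rfl

theorem mderiv_neg (f : ℝ → Matrix m k ℝ) (t : ℝ) :
    mderiv (fun s => -f s) t = -mderiv f t := by
  ext i j
  simp [mderiv]

theorem mderiv_add {f g : ℝ → Matrix m k ℝ}
    (hf : ∀ i j, Differentiable ℝ fun s => f s i j)
    (hg : ∀ i j, Differentiable ℝ fun s => g s i j) (t : ℝ) :
    mderiv (fun s => f s + g s) t = mderiv f t + mderiv g t := by
  ext i j
  exact deriv_fun_add (hf i j t) (hg i j t)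

theorem mderiv_sub {f g : ℝ → Matrix m k ℝ}
    (hf : ∀ i j, Differentiable ℝ fun s => f s i j)
    (hg : ∀ i j, Differentiable ℝ fun s => g s i j) (t : ℝ) :
    mderiv (fun s => f s - g s) t = mderiv f t - mderiv g t := by
  ext i j
  exact deriv_fun_sub (hf i j t) (hg i j t)

theorem differentiable_mul_apply [Fintype k] {f : ℝ → Matrix m k ℝ} {g : ℝ → Matrix k o ℝ}
    (hf : ∀ i j, Differentiable ℝ fun s => f s i j)
    (hg : ∀ i j, Differentiable ℝ fun s => g s i j) (i : m) (j : o) :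
    Differentiable ℝ fun s => (f s * g s) i j := by
  simp only [Matrix.mul_apply]
  exact Differentiable.fun_sum fun x _ => (hf i x).mul (hg x j)

theorem differentiable_transpose_apply {f : ℝ → Matrix m k ℝ}
    (hf : ∀ i j, Differentiable ℝ fun s => f s i j) (i : k) (j : m) :
    Differentiable ℝ fun s => (f s)ᵀ i j :=
  hf j i

theorem mderiv_mul [Fintype k] {f : ℝ → Matrix m k ℝ} {g : ℝ → Matrix k o ℝ}
    (hf : ∀ i j, Differentiable ℝ fun s => f s i j)
    (hg : ∀ i j, Differentiable ℝ fun s => g s i j) (t : ℝ) :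
    mderiv (fun s => f s * g s) t = mderiv f t * g t + f t * mderiv g t := by
  ext i j
  have h : HasDerivAt (fun s => ∑ x, f s i x * g s x j)
      (∑ x, (deriv (fun s => f s i x) t * g t x j + f t i x * deriv (fun s => g s x j) t)) t :=
    HasDerivAt.fun_sum fun x _ => (hf i x t).hasDerivAt.mul (hg x j t).hasDerivAt
  rw [Finset.sum_add_distrib] at h
  exact h.deriv

end mderiv

/-- The block relations defining the symplectic group. -/
theorem symplectic_block_relations {n : ℕ} {a b c d : Matrix (Fin n) (Fin n) ℝ}
    (h : (fromBlocks a b c d)ᵀ * Jmat n * fromBlocks a b c d = Jmat n) :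
    aᵀ * c = cᵀ * a ∧ aᵀ * d - cᵀ * b = 1 ∧ dᵀ * a - bᵀ * c = 1 ∧ bᵀ * d = dᵀ * b := by
  simp only [Jmat, fromBlocks_transpose, fromBlocks_multiply, Matrix.mul_zero, Matrix.mul_one,
    Matrix.mul_neg, zero_add, add_zero, fromBlocks_inj, Matrix.neg_mul] at h
  obtain ⟨h1, h2, h3, h4⟩ := h
  refine ⟨(neg_add_eq_zero.mp h1).symm, ?_, ?_, (neg_add_eq_zero.mp h4).symm⟩
  · rw [← h2]; abel
  · rw [← neg_inj, ← h3]; abel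

/-- Maurer–Cartan decomposition for the real Jacobi group: for a differentiable curve
`g(t)` in the embedded Jacobi group, `g⁻¹g'` has the stated block form, and the
one-forms `λ^F = dᵗb' − bᵗd'`, `λ^G = −cᵗa' + aᵗc'` are symmetric. -/
theorem maurer_cartan_jacobi (n : ℕ)
    (a b c d : ℝ → Matrix (Fin n) (Fin n) ℝ)
    (lam mu : ℝ → Matrix (Fin 1) (Fin n) ℝ) (κ : ℝ → ℝ)
    (ha : ∀ i j, Differentiable ℝ fun t => a t i j)
    (hb : ∀ i j, Differentiable ℝ fun t => b t i j)
    (hc : ∀ i j, Differentiable ℝ fun t => c t i j)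
    (hd : ∀ i j, Differentiable ℝ fun t => d t i j)
    (hlam : ∀ i j, Differentiable ℝ fun t => lam t i j)
    (hmu : ∀ i j, Differentiable ℝ fun t => mu t i j)
    (hκ : Differentiable ℝ κ)
    (hM : ∀ t, (fromBlocks (a t) (b t) (c t) (d t))ᵀ * Jmat n *
      fromBlocks (a t) (b t) (c t) (d t) = Jmat n) (t : ℝ) :
    letI p : ℝ → Matrix (Fin 1) (Fin n) ℝ := fun s => lam s * (d s)ᵀ - mu s * (c s)ᵀ
    letI q : ℝ → Matrix (Fin 1) (Fin n) ℝ := fun s => -(lam s * (b s)ᵀ) + mu s * (a s)ᵀ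
    letI g : ℝ → Matrix ((Fin n ⊕ Fin 1) ⊕ (Fin n ⊕ Fin 1))
        ((Fin n ⊕ Fin 1) ⊕ (Fin n ⊕ Fin 1)) ℝ := fun s =>
      fromBlocks
        (fromBlocks (a s) 0 (lam s) 1)
        (fromBlocks (b s) (q s)ᵀ (mu s) !![κ s])
        (fromBlocks (c s) 0 0 0)
        (fromBlocks (d s) (-(p s)ᵀ) 0 1)
    letI a' := mderiv a t
    letI b' := mderiv b t
    letI c' := mderiv c t
    letI d' := mderiv d t
    letI lam' := mderiv lam t
    letI mu' := mderiv mu t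
    letI p' := mderiv p t
    letI q' := mderiv q t
    letI A11 := (d t)ᵀ * a' - (b t)ᵀ * c'
    letI A13 := (d t)ᵀ * b' - (b t)ᵀ * d'
    letI A21 := lam' - p t * a' - q t * c'
    letI A23 := mu' - p t * b' - q t * d'
    letI A24 := deriv κ t - (p t * q'ᵀ) 0 0 + (q t * p'ᵀ) 0 0
    letI A31 := -(c t)ᵀ * a' + (a t)ᵀ * c'
    (g t)⁻¹ * mderiv g t =
      fromBlocks
        (fromBlocks A11 0 A21 0)
        (fromBlocks A13 A23ᵀ A23 !![A24])
        (fromBlocks A31 0 0 0)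
        (fromBlocks (-A11ᵀ) (-A21ᵀ) 0 0) ∧
    A13ᵀ = A13 ∧ A31ᵀ = A31 := by
  set p : ℝ → Matrix (Fin 1) (Fin n) ℝ := fun s => lam s * (d s)ᵀ - mu s * (c s)ᵀ
  set q : ℝ → Matrix (Fin 1) (Fin n) ℝ := fun s => -(lam s * (b s)ᵀ) + mu s * (a s)ᵀ
  set g : ℝ → Matrix ((Fin n ⊕ Fin 1) ⊕ (Fin n ⊕ Fin 1)) ((Fin n ⊕ Fin 1) ⊕ (Fin n ⊕ Fin 1)) ℝ :=
    fun s => fromBlocks (fromBlocks (a s) 0 (lam s) 1) (fromBlocks (b s) (q s)ᵀ (mu s) !![κ s])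
      (fromBlocks (c s) 0 0 0) (fromBlocks (d s) (-(p s)ᵀ) 0 1)
  set a' := mderiv a t
  set b' := mderiv b t
  set c' := mderiv c t
  set d' := mderiv d t
  set lam' := mderiv lam t
  set mu' := mderiv mu t
  set p' := mderiv p t
  set q' := mderiv q t
  have hac s := (symplectic_block_relations (hM s)).1
  have had s := (symplectic_block_relations (hM s)).2.1
  have hda s := (symplectic_block_relations (hM s)).2.2.1
  have hbd s := (symplectic_block_relations (hM s)).2.2.2
  have hat := differentiable_transpose_apply ha
  have hbt := differentiable_transpose_apply hb
  have hct := differentiable_transpose_apply hc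
  have hdt := differentiable_transpose_apply hd
  have hp : ∀ i j, Differentiable ℝ fun s => p s i j := fun i j =>
    (differentiable_mul_apply hlam hdt i j).sub
      (differentiable_mul_apply hmu hct i j)
  have hq : ∀ i j, Differentiable ℝ fun s => q s i j := fun i j =>
    (differentiable_mul_apply hlam hbt i j).neg.add
      (differentiable_mul_apply hmu hat i j)
  have hlam_eq s : p s * a s + q s * c s = lam s := by
    calc p s * a s + q s * c s
        = lam s * ((d s)ᵀ * a s - (b s)ᵀ * c s) + mu s * ((a s)ᵀ * c s - (c s)ᵀ * a s) := by
          simp only [p, q, Matrix.add_mul, Matrix.sub_mul, Matrix.neg_mul, Matrix.mul_sub,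
            Matrix.mul_assoc]
          abel
      _ = lam s := by simp [hda, hac]
  have hmu_eq s : p s * b s + q s * d s = mu s := by
    calc p s * b s + q s * d s
        = mu s * ((a s)ᵀ * d s - (c s)ᵀ * b s) - lam s * ((b s)ᵀ * d s - (d s)ᵀ * b s) := by
          simp only [p, q, Matrix.add_mul, Matrix.sub_mul, Matrix.neg_mul, Matrix.mul_sub,
            Matrix.mul_assoc]
          abel
      _ = mu s := by simp [had, hbd]
  clear_value p q
  have hlam' : lam' = p' * a t + p t * a' + (q' * c t + q t * c') := by
    rw [← mderiv_mul hp ha, ← mderiv_mul hq hc,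
      ← mderiv_add (differentiable_mul_apply hp ha) (differentiable_mul_apply hq hc)]
    exact mderiv_congr (fun s => (hlam_eq s).symm) t
  have hmu' : mu' = p' * b t + p t * b' + (q' * d t + q t * d') := by
    rw [← mderiv_mul hp hb, ← mderiv_mul hq hd,
      ← mderiv_add (differentiable_mul_apply hp hb) (differentiable_mul_apply hq hd)]
    exact mderiv_congr (fun s => (hmu_eq s).symm) t
  have hac' : a'ᵀ * c t + (a t)ᵀ * c' = c'ᵀ * a t + (c t)ᵀ * a' := by
    have h := mderiv_congr hac t
    rwa [mderiv_mul hat hc, mderiv_mul hct ha] at h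
  have hbd' : b'ᵀ * d t + (b t)ᵀ * d' = d'ᵀ * b t + (d t)ᵀ * b' := by
    have h := mderiv_congr hbd t
    rwa [mderiv_mul hbt hd, mderiv_mul hdt hb] at h
  have had' : a'ᵀ * d t + (a t)ᵀ * d' - (c'ᵀ * b t + (c t)ᵀ * b') = 0 := by
    have h := mderiv_congr had t
    rwa [mderiv_const, mderiv_sub (differentiable_mul_apply hat hd)
      (differentiable_mul_apply hct hb),
      mderiv_mul hat hd, mderiv_mul hct hb] at h
  have hκ' : mderiv (fun s => !![κ s]) t = !![deriv κ t] := by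
    ext i j
    fin_cases i; fin_cases j
    rfl
  have hg' : mderiv g t = fromBlocks (fromBlocks a' 0 lam' 0)
      (fromBlocks b' q'ᵀ mu' !![deriv κ t]) (fromBlocks c' 0 0 0)
      (fromBlocks d' (-p'ᵀ) 0 0) := by
    simp only [g, mderiv_fromBlocks, mderiv_const, mderiv_neg, mderiv_transpose, hκ']
    rfl
  have hpq : p t * (q t)ᵀ = q t * (p t)ᵀ := by
    rw [← Matrix.transpose_inj, Matrix.transpose_mul, Matrix.transpose_transpose]
    ext i j
    fin_cases i; fin_cases j
    simp [Matrix.mul_apply,]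
  have hinv : (g t)⁻¹ = fromBlocks (fromBlocks (d t)ᵀ 0 (-p t) 1)
      (fromBlocks (-(b t)ᵀ) (-(mu t)ᵀ) (-q t) (-!![κ t]))
      (fromBlocks (-(c t)ᵀ) 0 0 0) (fromBlocks (a t)ᵀ (lam t)ᵀ 0 1) := by
    refine Matrix.inv_eq_left_inv ?_
    have h_one : (1 : Matrix ((Fin n ⊕ Fin 1) ⊕ (Fin n ⊕ Fin 1))
        ((Fin n ⊕ Fin 1) ⊕ (Fin n ⊕ Fin 1)) ℝ) =
        fromBlocks (fromBlocks 1 0 0 1) (fromBlocks 0 0 0 0) (fromBlocks 0 0 0 0)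
          (fromBlocks 1 0 0 1) := by
      simp
    simp only [g, h_one, fromBlocks_multiply, fromBlocks_add, fromBlocks_inj, Matrix.mul_zero,
      Matrix.zero_mul, Matrix.mul_one, Matrix.one_mul, Matrix.neg_mul, Matrix.mul_neg, add_zero,
      zero_add, neg_neg, neg_zero, and_true, true_and]
    refine ⟨⟨?_, ?_⟩, ⟨?_, ?_, ?_, ?_⟩, ?_, ?_, ?_⟩
    · linear_combination (norm := abel) hda t
    · linear_combination (norm := abel) -hlam_eq t
    · linear_combination (norm := abel) -hbd t
    · rw [← hmu_eq t, transpose_add, transpose_mul, transpose_mul]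
      abel
    · linear_combination (norm := abel) -hmu_eq t
    · linear_combination (norm := abel) -hpq
    · linear_combination (norm := abel) hac t
    · linear_combination (norm := abel) had t
    · rw [← hlam_eq t, transpose_add, transpose_mul, transpose_mul]
      abel
  refine ⟨?_, ?_, ?_⟩
  · rw [hinv, hg']
    simp only [fromBlocks_multiply, fromBlocks_add, fromBlocks_inj, Matrix.mul_zero,
      Matrix.zero_mul, Matrix.one_mul, Matrix.neg_mul, Matrix.mul_neg, add_zero,
      neg_neg, neg_zero, and_true, true_and]
    refine ⟨⟨?_, ?_⟩, ⟨?_, ?_, ?_, ?_⟩, ?_, ?_⟩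
    · abel
    · abel
    · abel
    · rw [hmu']
      simp only [transpose_add, transpose_sub, transpose_mul]
      abel
    · abel
    · ext i j
      fin_cases i; fin_cases j
      simp
      ring
    · simp only [transpose_sub, transpose_mul, transpose_transpose]
      linear_combination (norm := abel) had'
    · rw [hlam']
      simp only [transpose_add, transpose_sub, transpose_mul]
      abel
  · simp only [transpose_sub, transpose_mul, transpose_transpose]
    linear_combination (norm := abel) hbd'
  · simp only [transpose_add, transpose_neg, transpose_mul, transpose_transpose,
      Matrix.neg_mul]
    linear_combination (norm := abel) -hac'
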